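/- Let {j_1,…,j_t} ⊆ {1,…,n}, (a_1,…,a_t) ∈ ℕ^t, and let I_0 ⊆ K{y_1,…,y_n} be a pure binomial σ-ideal such that I = ⟨I_0 ∪ {y_{j_1}^{x^{a_1}},…,y_{j_t}^{x^{a_t}}}⟩_r is quasi-normal. Then I is finitely generated as a radical well-mixed σ-ideal. -/

import Mathlib

open Polynomial

section SigmaRing

variable {R : Type*} [CommRing R]

/-- A σ-ideal: an ideal closed under the difference operator σ. -/
def IsSigmaIdeal (σ : R →+* R) (I : Ideal R) : Prop := ∀ a ∈ I, σ a ∈ I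

/-- A σ-ideal is well-mixed if `a * b ∈ I` implies `a * σ b ∈ I`. -/
def IsWellMixed (σ : R →+* R) (I : Ideal R) : Prop := ∀ a b : R, a * b ∈ I → a * σ b ∈ I

/-- `[F]`, the smallest σ-ideal containing `F`. -/
def sigmaIdealGen (σ : R →+* R) (F : Set R) : Ideal R :=
  sInf {I : Ideal R | F ⊆ I ∧ IsSigmaIdeal σ I}

/-- `⟨F⟩`, the smallest well-mixed σ-ideal containing `F` (well-mixed closure). -/
def wmClosure (σ : R →+* R) (F : Set R) : Ideal R :=
  sInf {I : Ideal R | F ⊆ I ∧ IsSigmaIdeal σ I ∧ IsWellMixed σ I}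

/-- `⟨F⟩_r`, the smallest radical well-mixed σ-ideal containing `F`. -/
def rwmClosure (σ : R →+* R) (F : Set R) : Ideal R :=
  sInf {I : Ideal R | F ⊆ I ∧ IsSigmaIdeal σ I ∧ IsWellMixed σ I ∧ I.IsRadical}

/-- Symbolic exponent: for `p = Σ c_i x^i ∈ ℕ[x]`, `a^p = Π (σ^i a)^(c_i)`. -/
noncomputable def sexp (σ : R →+* R) (a : R) (p : Polynomial ℕ) : R :=
  ∏ i ∈ Finset.range (p.natDegree + 1), ((⇑σ)^[i] a) ^ (p.coeff i)

/-- `I` is finitely generated as a radical well-mixed σ-ideal. -/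
def FinGenAsRWM (σ : R →+* R) (I : Ideal R) : Prop :=
  ∃ G : Set R, G.Finite ∧ G ⊆ (I : Set R) ∧ I = rwmClosure σ G

/-- σ-prime: a reflexive σ-ideal which is prime. -/
def IsSigmaPrime (σ : R →+* R) (I : Ideal R) : Prop :=
  IsSigmaIdeal σ I ∧ (∀ a : R, σ a ∈ I → a ∈ I) ∧ I.IsPrime

end SigmaRing

/-- The σ-polynomial ring `K{y_1,…,y_n}`: polynomials in variables `y_i^{x^j}`,
indexed by pairs `(i, j) ∈ Fin n × ℕ`. -/
abbrev DPoly (K : Type*) [Field K] (n : ℕ) := MvPolynomial (Fin n × ℕ) K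

section DPoly

variable {K : Type*} [Field K] {n : ℕ} (σK : K →+* K)

/-- The difference operator on `K{y_1,…,y_n}` extending `σK`, with `σ(y_i^{x^j}) = y_i^{x^{j+1}}`. -/
noncomputable def shift : DPoly K n →+* DPoly K n :=
  MvPolynomial.eval₂Hom ((MvPolynomial.C : K →+* DPoly K n).comp σK)
    (fun v => MvPolynomial.X (v.1, v.2 + 1))

/-- `y_i^p` for `p ∈ ℕ[x]`. -/
noncomputable def ypow (i : Fin n) (p : Polynomial ℕ) : DPoly K n :=
  sexp (shift σK) (MvPolynomial.X (i, 0)) p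

/-- `y_i^{x^a}`. -/
noncomputable def varPow (i : Fin n) (a : ℕ) : DPoly K n :=
  ypow σK i (Polynomial.X ^ a)

/-- The monomial `Y^f = Π y_i^{f_i}` for `f ∈ ℕ[x]^n`. -/
noncomputable def monom (f : Fin n → Polynomial ℕ) : DPoly K n :=
  ∏ i, ypow σK i (f i)

/-- A pure binomial `Y^f − Y^g`. -/
def IsPureBinomial (p : DPoly K n) : Prop :=
  ∃ f g : Fin n → Polynomial ℕ, p = monom σK f - monom σK g

/-- A binomial `a·Y^f + b·Y^g` with `a, b ∈ K^×`. -/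
def IsBinomial (p : DPoly K n) : Prop :=
  ∃ (a b : K) (f g : Fin n → Polynomial ℕ), a ≠ 0 ∧ b ≠ 0 ∧
    p = MvPolynomial.C a * monom σK f + MvPolynomial.C b * monom σK g

/-- A pure binomial σ-ideal: a σ-ideal generated by pure binomials. -/
def IsPureBinomialSigmaIdeal (I : Ideal (DPoly K n)) : Prop :=
  ∃ S : Set (DPoly K n), (∀ p ∈ S, IsPureBinomial σK p) ∧ I = sigmaIdealGen (shift σK) S

/-- Positive part of `f ∈ ℤ[x]`. -/
noncomputable def posPart (f : Polynomial ℤ) : Polynomial ℕ :=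
  f.sum fun i c => Polynomial.monomial i c.toNat

/-- Negative part of `f ∈ ℤ[x]`. -/
noncomputable def negPart (f : Polynomial ℤ) : Polynomial ℕ :=
  f.sum fun i c => Polynomial.monomial i (-c).toNat

/-- The lattice σ-ideal `I_L = [Y^{f_+} − Y^{f_−} : f ∈ L]` of a ℤ[x]-lattice `L ⊆ ℤ[x]^n`. -/
noncomputable def latticeIdeal (L : Submodule (Polynomial ℤ) (Fin n → Polynomial ℤ)) :
    Ideal (DPoly K n) :=
  sigmaIdealGen (shift σK)
    {p | ∃ f ∈ L, p = monom σK (fun i => posPart (f i)) - monom σK (fun i => negPart (f i))}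

end DPoly

/-- `𝔪`: the multiplicatively closed set generated by the variables `y_i^{x^j}`. -/
def mSet (K : Type*) [Field K] (n : ℕ) : Set (DPoly K n) :=
  (Submonoid.closure (Set.range fun v : Fin n × ℕ => (MvPolynomial.X v : DPoly K n)) : Set _)

/-- `I : 𝔪 = {p : M p ∈ I for some M ∈ 𝔪}`. -/
def colonM {K : Type*} [Field K] {n : ℕ} (I : Ideal (DPoly K n)) : Set (DPoly K n) :=
  {p | ∃ M ∈ mSet K n, M * p ∈ I}

section Tsec

variable {K : Type*} [Field K] {n t : ℕ} (σK : K →+* K)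

/-- The set `T^{a_1…a_t}_{j_1…j_t}` of monomials `Y^f` with `deg f_{j_i} < a_i`. -/
def Tset (j : Fin t → Fin n) (a : Fin t → ℕ) : Set (DPoly K n) :=
  {p | ∃ f : Fin n → Polynomial ℕ,
    (∀ i : Fin t, (f (j i)).degree < (a i : WithBot ℕ)) ∧ p = monom σK f}

/-- `I` is saturated with respect to `{y_{j_1}^{x^{a_1}},…,y_{j_t}^{x^{a_t}}}`. -/
def SaturatedWrt (j : Fin t → Fin n) (a : Fin t → ℕ) (I : Ideal (DPoly K n)) : Prop :=
  ∀ g M : DPoly K n, M ∈ Tset σK j a → M * g ∈ I → g ∈ I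

/-- `J : T = {g : M g ∈ J for some M ∈ T}`. -/
def colonT (j : Fin t → Fin n) (a : Fin t → ℕ) (J : Ideal (DPoly K n)) : Set (DPoly K n) :=
  {g | ∃ M ∈ Tset σK j a, M * g ∈ J}

/-- The `T`-saturated closure `N^{a_1…a_t}_{j_1…j_t}(I)`: the smallest saturated σ-ideal
containing `I`. -/
noncomputable def Nclosure (j : Fin t → Fin n) (a : Fin t → ℕ) (I : Ideal (DPoly K n)) :
    Ideal (DPoly K n) :=
  sInf {J : Ideal (DPoly K n) | I ≤ J ∧ IsSigmaIdeal (shift σK) J ∧ SaturatedWrt σK j a J}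

/-- The set of variables `{y_{j_1}^{x^{a_1}},…,y_{j_t}^{x^{a_t}}}`. -/
noncomputable def varSet (j : Fin t → Fin n) (a : Fin t → ℕ) : Set (DPoly K n) :=
  Set.range fun i => varPow σK (j i) (a i)

/-- `⟨I₀ ∪ {y_{j_1}^{x^{a_1}},…,y_{j_t}^{x^{a_t}}}⟩_r` is quasi-normal. -/
def QuasiNormal (j : Fin t → Fin n) (a : Fin t → ℕ) (I0 : Ideal (DPoly K n)) : Prop :=
  SaturatedWrt σK j a I0 ∧
  ∀ f g : Fin n → Polynomial ℕ, monom σK f - monom σK g ∈ I0 →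
    monom σK f ∈ sigmaIdealGen (shift σK) (varSet σK j a) →
    monom σK g ∈ sigmaIdealGen (shift σK) (varSet σK j a)

end Tsec

/-- Moving every position `(i, m)` of a finitely supported family to `(i, m + s)`. -/
noncomputable def shiftExp {n : ℕ} {M : Type*} [AddCommMonoid M] (s : ℕ)
    (u : Fin n × ℕ →₀ M) : Fin n × ℕ →₀ M :=
  u.mapDomain fun τ => (τ.1, τ.2 + s)

section Translate

variable {n : ℕ} {M : Type*} [AddCommMonoid M]

theorem shiftExp_pos_injective (s : ℕ) :
    Function.Injective fun τ : Fin n × ℕ => (τ.1, τ.2 + s) := by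
  rintro ⟨i, m⟩ ⟨i', m'⟩ h
  simpa using h

theorem shiftExp_apply (s : ℕ) (u : Fin n × ℕ →₀ M) (τ : Fin n × ℕ) :
    shiftExp s u (τ.1, τ.2 + s) = u τ :=
  Finsupp.mapDomain_apply (shiftExp_pos_injective s) u τ

theorem exists_of_shiftExp_ne_zero {s : ℕ} {u : Fin n × ℕ →₀ M} {τ : Fin n × ℕ}
    (h : shiftExp s u τ ≠ 0) : ∃ τ' : Fin n × ℕ, τ = (τ'.1, τ'.2 + s) := by
  by_contra hτ
  refine h (Finsupp.mapDomain_of_notMem_range u τ ?_)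
  rintro ⟨τ', rfl⟩
  exact hτ ⟨τ', rfl⟩

theorem shiftExp_zero (u : Fin n × ℕ →₀ M) : shiftExp 0 u = u := by
  exact Finsupp.mapDomain_id

theorem shiftExp_shiftExp (s s' : ℕ) (u : Fin n × ℕ →₀ M) :
    shiftExp s' (shiftExp s u) = shiftExp (s + s') u := by
  simp only [shiftExp, ← Finsupp.mapDomain_comp, Function.comp_def, add_assoc]

end Translate

/-- The information about a prime σ-ideal used below: the variables outside it (`alive`), and the
exponent vectors `u` of the pure binomials `Y^{u₊} - Y^{u₋}` inside it (`good`). -/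
structure BinomialModel (n : ℕ) where
  alive : Set (Fin n × ℕ)
  good : Set (Fin n × ℕ →₀ ℤ)
  alive_of_succ : ∀ i m, (i, m + 1) ∈ alive → (i, m) ∈ alive
  zero_mem : 0 ∈ good
  neg_mem : ∀ u ∈ good, -u ∈ good
  add_mem : ∀ u ∈ good, ∀ v ∈ good, (∀ τ, u τ ≠ 0 → τ ∈ alive) →
    (∀ τ, v τ ≠ 0 → τ ∈ alive) → u + v ∈ good
  shiftExp_mem : ∀ u ∈ good, shiftExp 1 u ∈ good
  mem_of_dead : ∀ u : Fin n × ℕ →₀ ℤ, (∃ τ, 0 < u τ ∧ τ ∉ alive) →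
    (∃ τ, u τ < 0 ∧ τ ∉ alive) → u ∈ good
  alive_pos : ∀ u ∈ good, (∀ τ, u τ < 0 → τ ∈ alive) → ∀ τ, 0 < u τ → τ ∈ alive

namespace BinomialModel

variable {n : ℕ} (M : BinomialModel n)

theorem alive_of_le {i : Fin n} {m m' : ℕ} (h : m ≤ m') (h' : (i, m') ∈ M.alive) :
    (i, m) ∈ M.alive := by
  induction m', h using Nat.le_induction with
  | base => exact h'
  | succ k _ ih => exact ih (M.alive_of_succ i k h')

theorem shiftExp_mem' (s : ℕ) {u : Fin n × ℕ →₀ ℤ} (hu : u ∈ M.good) :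
    shiftExp s u ∈ M.good := by
  induction s with
  | zero => rwa [shiftExp_zero]
  | succ s ih => rw [← shiftExp_shiftExp]; exact M.shiftExp_mem _ ih

/-- The good vectors supported in a set of alive positions form a subgroup. -/
def goodOn (S : Set (Fin n × ℕ)) (hS : S ⊆ M.alive) : AddSubgroup (Fin n × ℕ →₀ ℤ) where
  carrier := {u | u ∈ M.good ∧ ∀ τ, u τ ≠ 0 → τ ∈ S}
  zero_mem' := ⟨M.zero_mem, by simp⟩
  add_mem' := by
    rintro u v ⟨hu, hu'⟩ ⟨hv, hv'⟩
    refine ⟨M.add_mem u hu v hv (fun τ h => hS (hu' τ h)) (fun τ h => hS (hv' τ h)), ?_⟩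
    intro τ h
    by_cases h0 : u τ = 0
    · exact hv' τ (by simpa [h0] using h)
    · exact hu' τ h0
  neg_mem' := by
    rintro u ⟨hu, hu'⟩
    exact ⟨M.neg_mem u hu, fun τ h => hu' τ (by simpa using h)⟩

open Classical in
theorem exists_bound (H : ℕ) (i : Fin n) :
    ∃ b : ℕ, ∀ m, m < b ↔ m < H ∧ (i, m) ∈ M.alive := by
  have hex : ∃ b, ¬(b < H ∧ (i, b) ∈ M.alive) := ⟨H, by simp⟩
  refine ⟨Nat.find hex, fun m => ⟨fun h => not_not.1 (Nat.find_min hex h), fun h => ?_⟩⟩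
  exact lt_of_not_ge fun hm => Nat.find_spec hex ⟨hm.trans_lt h.1, M.alive_of_le hm h.2⟩

end BinomialModel

section Limit

variable {n : ℕ} {ι : Type*} (𝒰 : Ultrafilter ι) (β : ι → Fin n → ℕ)

/-- The distance of a position to the bound `β`, along the ultrafilter. -/
def slack (τ : Fin n × ℕ) : Filter.Germ (𝒰 : Filter ι) ℤ :=
  ((fun k => (β k τ.1 : ℤ) - τ.2 : ι → ℤ) : Filter.Germ (𝒰 : Filter ι) ℤ)

/-- Positions ordered by slack, ties broken by the index of the variable. -/
def slackKey (τ : Fin n × ℕ) : Filter.Germ (𝒰 : Filter ι) ℤ ×ₗ Fin n :=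
  toLex (slack 𝒰 β τ, τ.1)

/-- The positions eventually below the bound `β`. -/
def limitRegion : Set (Fin n × ℕ) := {τ | ∀ᶠ k in (𝒰 : Filter ι), τ.2 < β k τ.1}

variable {𝒰 β}

theorem slack_le_iff {τ τ' : Fin n × ℕ} : slack 𝒰 β τ ≤ slack 𝒰 β τ' ↔
    ∀ᶠ k in (𝒰 : Filter ι), (β k τ.1 : ℤ) - τ.2 ≤ (β k τ'.1 : ℤ) - τ'.2 :=
  Filter.Germ.coe_le

theorem slack_lt_iff {τ τ' : Fin n × ℕ} : slack 𝒰 β τ < slack 𝒰 β τ' ↔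
    ∀ᶠ k in (𝒰 : Filter ι), (β k τ.1 : ℤ) - τ.2 < (β k τ'.1 : ℤ) - τ'.2 :=
  Filter.Germ.coe_lt

theorem slack_eq_iff {τ τ' : Fin n × ℕ} : slack 𝒰 β τ = slack 𝒰 β τ' ↔
    ∀ᶠ k in (𝒰 : Filter ι), (β k τ.1 : ℤ) - τ.2 = (β k τ'.1 : ℤ) - τ'.2 :=
  Filter.Germ.coe_eq

theorem slackKey_le_iff {τ τ' : Fin n × ℕ} : slackKey 𝒰 β τ ≤ slackKey 𝒰 β τ' ↔
    slack 𝒰 β τ < slack 𝒰 β τ' ∨ slack 𝒰 β τ = slack 𝒰 β τ' ∧ τ.1 ≤ τ'.1 :=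
  Prod.Lex.toLex_le_toLex

theorem slack_le_of_slackKey_le {τ τ' : Fin n × ℕ} (h : slackKey 𝒰 β τ ≤ slackKey 𝒰 β τ') :
    slack 𝒰 β τ ≤ slack 𝒰 β τ' := by
  rcases slackKey_le_iff.1 h with h | h
  exacts [h.le, h.1.le]

theorem slackKey_injective : Function.Injective (slackKey 𝒰 β) := by
  rintro ⟨i, m⟩ ⟨i', m'⟩ h
  have h1 : slack 𝒰 β (i, m) = slack 𝒰 β (i', m') := congrArg (fun x => (ofLex x).1) h
  have h2 : i = i' := congrArg (fun x => (ofLex x).2) h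
  subst h2
  obtain ⟨k, hk⟩ := (slack_eq_iff.1 h1).exists
  simp only [Prod.mk.injEq, true_and]
  simp only at hk
  omega

theorem slackKey_add_le {τ τ' : Fin n × ℕ} (s : ℕ) (h : slackKey 𝒰 β τ ≤ slackKey 𝒰 β τ') :
    slackKey 𝒰 β (τ.1, τ.2 + s) ≤ slackKey 𝒰 β (τ'.1, τ'.2 + s) := by
  rw [slackKey_le_iff, slack_lt_iff, slack_eq_iff] at h ⊢
  refine h.imp (fun h => h.mono fun k hk => ?_) fun h => ⟨h.1.mono fun k hk => ?_, h.2⟩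
  all_goals
    push_cast
    linarith

theorem limitRegion_of_le {i : Fin n} {m m' : ℕ} (h : m ≤ m') (h' : (i, m') ∈ limitRegion 𝒰 β) :
    (i, m) ∈ limitRegion 𝒰 β :=
  Filter.Eventually.mono h' fun _ hk => h.trans_lt hk

theorem limitRegion_of_slackKey_le {τ τ' : Fin n × ℕ} (h : slackKey 𝒰 β τ ≤ slackKey 𝒰 β τ')
    (hτ : τ ∈ limitRegion 𝒰 β) : τ' ∈ limitRegion 𝒰 β := by
  filter_upwards [slack_le_iff.1 (slack_le_of_slackKey_le h), hτ] with k hk hk'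
  omega

variable (𝒰 β)

/-- The elements of `L` supported in the limit region and with leading position at most `τ`. -/
noncomputable def leadingBelow (L : AddSubgroup (Fin n × ℕ →₀ ℤ)) (τ : Fin n × ℕ) :
    AddSubgroup (Fin n × ℕ →₀ ℤ) where
  carrier := {u | u ∈ L ∧ ∀ τ', u τ' ≠ 0 → τ' ∈ limitRegion 𝒰 β ∧
    slackKey 𝒰 β τ ≤ slackKey 𝒰 β τ'}
  zero_mem' := ⟨L.zero_mem, by simp⟩
  add_mem' := by
    rintro u v ⟨hu, hu'⟩ ⟨hv, hv'⟩
    refine ⟨L.add_mem hu hv, fun τ' h => ?_⟩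
    by_cases h0 : u τ' = 0
    · exact hv' τ' (by simpa [h0] using h)
    · exact hu' τ' h0
  neg_mem' := by
    rintro u ⟨hu, hu'⟩
    exact ⟨L.neg_mem hu, fun τ h => hu' τ (by simpa using h)⟩

/-- The ideal of leading coefficients at the position `τ`. -/
noncomputable def leadingCoeffs (L : AddSubgroup (Fin n × ℕ →₀ ℤ)) (τ : Fin n × ℕ) :
    AddSubgroup ℤ :=
  (leadingBelow 𝒰 β L τ).map (Finsupp.applyAddHom τ)

variable {𝒰 β}

theorem shiftExp_mem_leadingBelow {L : AddSubgroup (Fin n × ℕ →₀ ℤ)}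
    (hL : ∀ u ∈ L, (∀ τ, shiftExp 1 u τ ≠ 0 → τ ∈ limitRegion 𝒰 β) → shiftExp 1 u ∈ L)
    {τ : Fin n × ℕ} {u : Fin n × ℕ →₀ ℤ} (hu : u ∈ leadingBelow 𝒰 β L τ) (s : ℕ)
    (hτ : (τ.1, τ.2 + s) ∈ limitRegion 𝒰 β) :
    shiftExp s u ∈ leadingBelow 𝒰 β L (τ.1, τ.2 + s) := by
  have key : ∀ τ', shiftExp s u τ' ≠ 0 → τ' ∈ limitRegion 𝒰 β ∧
      slackKey 𝒰 β (τ.1, τ.2 + s) ≤ slackKey 𝒰 β τ' := by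
    intro τ' h
    obtain ⟨τ', rfl⟩ := exists_of_shiftExp_ne_zero h
    rw [shiftExp_apply] at h
    have := slackKey_add_le s (hu.2 τ' h).2
    exact ⟨limitRegion_of_slackKey_le this hτ, this⟩
  refine ⟨?_, key⟩
  induction s with
  | zero => rw [shiftExp_zero]; exact hu.1
  | succ s ih =>
    have hτ' := limitRegion_of_le (Nat.le_succ _) hτ
    rw [← shiftExp_shiftExp] at key ⊢
    refine hL _ (ih hτ' fun τ' h => ?_) fun τ' h => (key τ' h).1
    obtain ⟨τ', rfl⟩ := exists_of_shiftExp_ne_zero h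
    rw [shiftExp_apply] at h
    have := slackKey_add_le s (hu.2 τ' h).2
    have hmem := limitRegion_of_slackKey_le this hτ'
    exact ⟨hmem, this⟩

/-- A finite standard basis for the vectors of `L` supported in the limit region. -/
theorem exists_standard_basis {L : AddSubgroup (Fin n × ℕ →₀ ℤ)}
    (hL : ∀ u ∈ L, (∀ τ, shiftExp 1 u τ ≠ 0 → τ ∈ limitRegion 𝒰 β) → shiftExp 1 u ∈ L) :
    ∃ B : Set ((Fin n × ℕ) × (Fin n × ℕ →₀ ℤ)), B.Finite ∧
      (∀ b ∈ B, b.2 ∈ leadingBelow 𝒰 β L b.1) ∧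
      ∀ τ ∈ limitRegion 𝒰 β, ∀ u ∈ leadingBelow 𝒰 β L τ, ∃ b ∈ B, ∃ (s : ℕ) (c : ℤ),
        τ = (b.1.1, b.1.2 + s) ∧ u τ = c * b.2 b.1 := by
  classical
  have hgen : ∀ τ, ∃ v ∈ leadingBelow 𝒰 β L τ, ∀ u ∈ leadingBelow 𝒰 β L τ,
      ∃ c : ℤ, u τ = c * v τ := by
    intro τ
    obtain ⟨a, ha⟩ := Int.subgroup_cyclic (leadingCoeffs 𝒰 β L τ)
    have haL : a ∈ leadingCoeffs 𝒰 β L τ := by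
      rw [ha]; exact AddSubgroup.subset_closure rfl
    obtain ⟨v, hv, hva⟩ := haL
    refine ⟨v, hv, fun u hu => ?_⟩
    have huL : u τ ∈ leadingCoeffs 𝒰 β L τ := ⟨u, hu, rfl⟩
    rw [ha, AddSubgroup.mem_closure_singleton] at huL
    obtain ⟨c, hc⟩ := huL
    refine ⟨c, ?_⟩
    rw [← hc, ← hva]
    simp
  choose v hv hvgen using hgen
  have hstab : ∀ i : Fin n, ∃ N : ℕ, ∀ m, N ≤ m → (i, m) ∈ limitRegion 𝒰 β →
      leadingCoeffs 𝒰 β L (i, N) = leadingCoeffs 𝒰 β L (i, m) := by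
    intro i
    by_cases hi : ∀ m, (i, m) ∈ limitRegion 𝒰 β
    · have hmono : Monotone fun m => (leadingCoeffs 𝒰 β L (i, m)).toIntSubmodule := by
        refine monotone_nat_of_le_succ fun m => ?_
        rintro _ ⟨u, hu, rfl⟩
        refine ⟨shiftExp 1 u, shiftExp_mem_leadingBelow hL hu 1 (hi _), ?_⟩
        exact shiftExp_apply 1 u (i, m)
      obtain ⟨N, hN⟩ := monotone_stabilizes_iff_noetherian.2
        (inferInstance : IsNoetherian ℤ ℤ) ⟨_, hmono⟩
      exact ⟨N, fun m hm _ => AddSubgroup.toIntSubmodule.injective (hN m hm)⟩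
    · push Not at hi
      obtain ⟨N, hN⟩ := hi
      exact ⟨N, fun m hm h => absurd (limitRegion_of_le hm h) hN⟩
  choose N hN using hstab
  refine ⟨(fun τ => (τ, v τ)) '' {τ | τ.2 ≤ N τ.1}, ?_, ?_, ?_⟩
  · refine Set.Finite.image _ ?_
    refine (Set.finite_iUnion fun i => (Set.finite_Iic (N i)).image fun m => (i, m)).subset ?_
    rintro ⟨i, m⟩ h
    exact Set.mem_iUnion.2 ⟨i, m, h, rfl⟩
  · rintro _ ⟨τ, -, rfl⟩
    exact hv τ
  · rintro ⟨i, m⟩ hτ u hu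
    have huL : u (i, m) ∈ leadingCoeffs 𝒰 β L (i, m) := ⟨u, hu, rfl⟩
    obtain ⟨m₀, s, hms, hm₀, heq⟩ : ∃ m₀ s, m = m₀ + s ∧ m₀ ≤ N i ∧
        leadingCoeffs 𝒰 β L (i, m₀) = leadingCoeffs 𝒰 β L (i, m) := by
      rcases le_total m (N i) with h | h
      · exact ⟨m, 0, rfl, h, rfl⟩
      · exact ⟨N i, m - N i, by omega, le_rfl, hN i m h hτ⟩
    rw [← heq] at huL
    obtain ⟨u', hu', hu'u⟩ := huL
    obtain ⟨c, hc⟩ := hvgen _ u' hu'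
    refine ⟨_, ⟨(i, m₀), hm₀, rfl⟩, s, c, by rw [hms], ?_⟩
    rw [← hc, ← hu'u]
    rfl

end Limit

section FiniteDetermination

variable {n : ℕ}

theorem eventually_forall_support {ι N : Type*} [Zero N] {l : Filter ι} (u : Fin n × ℕ →₀ N)
    {p : ι → Fin n × ℕ → Prop} (h : ∀ τ, u τ ≠ 0 → ∀ᶠ k in l, p k τ) :
    ∀ᶠ k in l, ∀ τ, u τ ≠ 0 → p k τ := by
  have := (Filter.eventually_all_finset (l := l) (p := fun τ k => p k τ) u.support).2
    fun τ hτ => h τ (by simpa using hτ)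
  exact this.mono fun k hk τ hτ => hk τ (by simpa using hτ)

theorem exists_lead {ι : Type*} {𝒰 : Ultrafilter ι} {β : ι → Fin n → ℕ}
    {u : Fin n × ℕ →₀ ℤ} (hu : u ≠ 0) :
    ∃ τ, u τ ≠ 0 ∧ ∀ τ', u τ' ≠ 0 → slackKey 𝒰 β τ ≤ slackKey 𝒰 β τ' := by
  obtain ⟨τ, hτ, hmin⟩ := u.support.exists_min_image (slackKey 𝒰 β)
    (Finsupp.support_nonempty_iff.2 hu)
  exact ⟨τ, by simpa using hτ, fun τ' h => hmin τ' (by simpa using h)⟩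

theorem eventually_not_limitRegion {ι : Type*} (𝒰 : Ultrafilter ι) (β : ι → Fin n → ℕ) :
    ∀ᶠ k in (𝒰 : Filter ι), ∀ τ ∉ limitRegion 𝒰 β, β k τ.1 ≤ τ.2 := by
  classical
  have : ∀ᶠ k in (𝒰 : Filter ι), ∀ i m, (i, m) ∉ limitRegion 𝒰 β → β k i ≤ m := by
    rw [Filter.eventually_all]
    intro i
    by_cases hi : ∃ m, (i, m) ∉ limitRegion 𝒰 β
    · have h := Nat.find_spec hi
      have h' := Ultrafilter.eventually_not.2 h
      filter_upwards [h'] with k hk m hm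
      exact (not_lt.1 hk).trans (Nat.find_min' hi hm)
    · push Not at hi
      exact Filter.Eventually.of_forall fun k m hm => absurd (hi m) hm
  exact this.mono fun k hk τ => hk τ.1 τ.2

theorem eventually_slack_eq {ι : Type*} (𝒰 : Ultrafilter ι) (β : ι → Fin n → ℕ) :
    ∀ᶠ k in (𝒰 : Filter ι), ∀ τ τ', slack 𝒰 β τ = slack 𝒰 β τ' →
      (β k τ.1 : ℤ) - τ.2 = (β k τ'.1 : ℤ) - τ'.2 := by
  have : ∀ᶠ k in (𝒰 : Filter ι), ∀ i i' m m', slack 𝒰 β (i, m) = slack 𝒰 β (i', m') →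
      (β k i : ℤ) - m = (β k i' : ℤ) - m' := by
    rw [Filter.eventually_all]
    intro i
    rw [Filter.eventually_all]
    intro i'
    by_cases h : ∃ m m', slack 𝒰 β (i, m) = slack 𝒰 β (i', m')
    · obtain ⟨m, m', h⟩ := h
      have h := slack_eq_iff.1 h
      filter_upwards [h] with k hk m₁ m₁' h₁
      obtain ⟨k', h1, h2⟩ := (h.and (slack_eq_iff.1 h₁)).exists
      simp only at h1 h2 hk
      omega
    · push Not at h
      exact Filter.Eventually.of_forall fun k m m' hm => absurd hm (h m m')
  exact this.mono fun k hk τ υ => hk τ.1 υ.1 τ.2 υ.2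

/-- A subgroup of exponent vectors stable under the shift inside the region `A` is contained in
the good vectors of a model with live positions in `A` as soon as a suitable finite part of it
is. -/
theorem exists_finset_determining (A : Set (Fin n × ℕ)) (L : AddSubgroup (Fin n × ℕ →₀ ℤ))
    (hL : ∀ u ∈ L, (∀ τ, shiftExp 1 u τ ≠ 0 → τ ∈ A) → shiftExp 1 u ∈ L) :
    ∃ F : Finset L, ∀ M : BinomialModel n, M.alive ⊆ A → (∀ u ∈ F, (u : Fin n × ℕ →₀ ℤ) ∈ M.good) →
      ∀ u ∈ L, u ∈ M.good := by
  by_contra! hcon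
  have hbad : ∀ F : Finset L, ∃ M : BinomialModel n, M.alive ⊆ A ∧
      (∀ u ∈ F, (u : Fin n × ℕ →₀ ℤ) ∈ M.good) ∧
      ∃ u ∈ L, u ∉ M.good ∧ ∀ τ, u τ < 0 → τ ∈ M.alive := by
    intro F
    obtain ⟨M, hMA, hMF, u, huL, hu⟩ := hcon F
    refine ⟨M, hMA, hMF, ?_⟩
    by_cases hneg : ∀ τ, u τ < 0 → τ ∈ M.alive
    · exact ⟨u, huL, hu, hneg⟩
    · push Not at hneg
      refine ⟨-u, L.neg_mem huL, fun h => hu (by simpa using M.neg_mem _ h), fun τ hτ => ?_⟩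
      by_contra hτ'
      exact hu (M.mem_of_dead u ⟨τ, by simpa using hτ, hτ'⟩ hneg)
  choose M hMA hMF w hwL hw hwneg using hbad
  have hH : ∀ F, ∃ H : ℕ, ∀ τ, w F τ ≠ 0 → τ.2 < H := fun F =>
    ⟨(w F).support.sup (fun τ => τ.2 + 1), fun τ hτ =>
      Finset.le_sup (f := fun τ : Fin n × ℕ => τ.2 + 1) (by simpa using hτ)⟩
  choose H hH using hH
  choose β hβ using fun F i => (M F).exists_bound (H F) i
  set 𝒰 : Ultrafilter (Finset L) := Ultrafilter.of Filter.atTop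
  have hgood : ∀ u ∈ L, ∀ᶠ F in (𝒰 : Filter (Finset L)), u ∈ (M F).good := by
    intro u hu
    refine Ultrafilter.of_le _ ((Filter.eventually_ge_atTop {⟨u, hu⟩}).mono fun F hF => ?_)
    exact hMF F ⟨u, hu⟩ (Finset.singleton_subset_iff.1 hF)
  have hβalive : ∀ F (τ : Fin n × ℕ), τ.2 < β F τ.1 → τ ∈ (M F).alive := fun F τ h =>
    ((hβ F τ.1 τ.2).1 h).2
  have hout : ∀ F (τ : Fin n × ℕ), β F τ.1 ≤ τ.2 → w F τ ≠ 0 →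
      0 < w F τ ∧ ∀ m, β F τ.1 ≤ m → (τ.1, m) ∉ (M F).alive := by
    intro F τ hτ hne
    have hdead : ∀ m, β F τ.1 ≤ m → (τ.1, m) ∉ (M F).alive := fun m hm hal =>
      lt_irrefl _ ((hβ F τ.1 (β F τ.1)).2
        ⟨hτ.trans_lt (hH F τ hne), (M F).alive_of_le hm hal⟩)
    refine ⟨lt_of_le_of_ne (not_lt.1 fun h => hdead τ.2 hτ (hwneg F τ h)) hne.symm, hdead⟩
  have hQA : limitRegion 𝒰 β ⊆ A := by
    intro τ hτ
    obtain ⟨F, hF⟩ := Filter.Eventually.exists hτ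
    exact hMA F (hβalive F τ hF)
  obtain ⟨B, hBfin, hB, hBgen⟩ := exists_standard_basis (𝒰 := 𝒰) (β := β)
    (fun u hu h => hL u hu fun τ hτ => hQA (h τ hτ))
  let S : Fin n → Set (Fin n × ℕ →₀ ℤ) := fun i =>
    {u | u ∈ L ∧ (∃ m, 0 < u (i, m) ∧ (i, m) ∉ limitRegion 𝒰 β) ∧
      ∀ τ, u τ < 0 → τ ∈ limitRegion 𝒰 β}
  let T : Fin n → Set (ℕ × (Fin n × ℕ →₀ ℤ)) := fun i =>
    {x | x.2 ∈ L ∧ (∀ τ, x.2 τ ≠ 0 → τ ∈ limitRegion 𝒰 β) ∧ 0 < x.2 (i, x.1) ∧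
      ∀ τ, x.2 τ < 0 → slack 𝒰 β (i, x.1) < slack 𝒰 β τ}
  have hB' : ∀ᶠ F in (𝒰 : Filter (Finset L)), ∀ b ∈ B, b.2 ∈ (M F).good ∧
      ∀ τ, b.2 τ ≠ 0 → (β F b.1.1 : ℤ) - b.1.2 ≤ (β F τ.1 : ℤ) - τ.2 := by
    rw [Filter.eventually_all_finite hBfin]
    intro b hb
    refine (hgood _ (hB b hb).1).and (eventually_forall_support b.2 fun τ hτ => ?_)
    exact slack_le_iff.1 (slack_le_of_slackKey_le ((hB b hb).2 τ hτ).2)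
  have hS : ∃ p : Fin n → (Fin n × ℕ →₀ ℤ), ∀ i, (S i).Nonempty → p i ∈ S i := by
    have : ∀ i, ∃ p, (S i).Nonempty → p ∈ S i := fun i => by
      by_cases h : (S i).Nonempty
      exacts [h.imp fun _ hp _ => hp, ⟨0, fun h' => absurd h' h⟩]
    exact Classical.skolem.1 this
  obtain ⟨p, hp⟩ := hS
  have hT : ∃ q : Fin n → ℕ × (Fin n × ℕ →₀ ℤ), ∀ i, (T i).Nonempty → q i ∈ T i := by
    have : ∀ i, ∃ q, (T i).Nonempty → q ∈ T i := fun i => by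
      by_cases h : (T i).Nonempty
      exacts [h.imp fun _ hq _ => hq, ⟨0, fun h' => absurd h' h⟩]
    exact Classical.skolem.1 this
  obtain ⟨q, hq⟩ := hT
  have hp' : ∀ᶠ F in (𝒰 : Filter (Finset L)), ∀ i, (S i).Nonempty → p i ∈ (M F).good ∧
      ∀ τ, p i τ ≠ 0 → p i τ < 0 → τ.2 < β F τ.1 := by
    rw [Filter.eventually_all]
    intro i
    rw [Filter.eventually_imp_distrib_left]
    intro hi
    refine (hgood _ (hp i hi).1).and (eventually_forall_support _ fun τ _ => ?_)
    rw [Filter.eventually_imp_distrib_left]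
    exact (hp i hi).2.2 τ
  have hq' : ∀ᶠ F in (𝒰 : Filter (Finset L)), ∀ i, (T i).Nonempty → (q i).2 ∈ (M F).good ∧
      ∀ τ, (q i).2 τ ≠ 0 → τ.2 < β F τ.1 ∧
        ((q i).2 τ < 0 → (β F i : ℤ) - (q i).1 < (β F τ.1 : ℤ) - τ.2) := by
    rw [Filter.eventually_all]
    intro i
    rw [Filter.eventually_imp_distrib_left]
    intro hi
    refine (hgood _ (hq i hi).1).and (eventually_forall_support _ fun τ hτ => ?_)
    refine Filter.Eventually.and ((hq i hi).2.1 τ hτ) ?_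
    rw [Filter.eventually_imp_distrib_left]
    exact fun h => slack_lt_iff.1 ((hq i hi).2.2.2 τ h)
  obtain ⟨F, hBF, hpF, hqF, hQF, heqF⟩ := (hB'.and (hp'.and (hq'.and
    ((eventually_not_limitRegion 𝒰 β).and (eventually_slack_eq 𝒰 β))))).exists
  have hwQ : ∀ τ, w F τ ≠ 0 → τ ∈ limitRegion 𝒰 β := by
    intro τ hτ
    by_contra hτQ
    obtain ⟨hpos, hdead⟩ := hout F τ (hQF τ hτQ) hτ
    have hne : (S τ.1).Nonempty := by
      refine ⟨w F, hwL F, ⟨τ.2, hpos, hτQ⟩, fun τ' h => ?_⟩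
      by_contra hτ'
      exact absurd (hout F τ' (hQF τ' hτ') h.ne).1 h.le.not_gt
    obtain ⟨-, ⟨m, hm, hmQ⟩, -⟩ := hp τ.1 hne
    refine hdead m (hQF _ hmQ) ((M F).alive_pos _ (hpF τ.1 hne).1 (fun τ' h => ?_) _ hm)
    exact hβalive F τ' ((hpF τ.1 hne).2 τ' h.ne h)
  let box : Set (Fin n × ℕ) := {τ | τ.2 < β F τ.1}
  have hbox : box.Finite := by
    refine (Set.finite_iUnion fun i => (Set.finite_Iio (β F i)).image fun m => (i, m)).subset ?_
    rintro ⟨i, m⟩ h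
    exact Set.mem_iUnion.2 ⟨i, m, h, rfl⟩
  let G := (M F).goodOn box fun τ h => hβalive F τ h
  let adm : Set (Fin n × ℕ →₀ ℤ) :=
    {u | u ∈ L ∧ (∀ τ, u τ ≠ 0 → τ ∈ limitRegion 𝒰 β) ∧ w F - u ∈ G}
  have hne0 : ∀ u ∈ adm, u ≠ 0 := by
    rintro _ hu rfl
    exact hw F (by simpa using hu.2.2.1)
  have hsame : ∀ u ∈ adm, ∀ τ, β F τ.1 ≤ τ.2 → w F τ = u τ := by
    intro u hu τ hτ
    by_contra h
    exact absurd (hu.2.2.2 τ (by simpa [sub_eq_zero] using h)) (not_lt.2 hτ)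
  have hlead : ∀ u ∈ adm, ∀ τ, u τ ≠ 0 → (∀ τ', u τ' ≠ 0 → slackKey 𝒰 β τ ≤ slackKey 𝒰 β τ') →
      τ ∈ box := by
    intro u hu τ hτ hmin
    by_contra hτbox
    have hle : β F τ.1 ≤ τ.2 := not_lt.1 hτbox
    have hwτ := hsame u hu τ hle
    obtain ⟨hpos, hdead⟩ := hout F τ hle (hwτ ▸ hτ)
    have hne : (T τ.1).Nonempty := by
      refine ⟨(τ.2, u), hu.1, hu.2.1, hwτ ▸ hpos, fun τ' h => ?_⟩
      refine lt_of_le_of_ne (slack_le_of_slackKey_le (hmin τ' h.ne)) fun heq => ?_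
      have h1 := heqF τ τ' heq
      have hle' : β F τ'.1 ≤ τ'.2 := by omega
      have hwτ' := hsame u hu τ' hle'
      exact absurd (hwτ' ▸ (hout F τ' hle' (hwτ' ▸ h.ne)).1) h.le.not_gt
    obtain ⟨hqgood, hqF'⟩ := hqF τ.1 hne
    have hqpos := (hq τ.1 hne).2.2.1
    have hm := (hqF' _ hqpos.ne').1
    simp only at hm
    have hal := (M F).alive_pos _ ((M F).shiftExp_mem' (β F τ.1 - (q τ.1).1) hqgood) (fun τ' h => ?_)
      (τ.1, (q τ.1).1 + (β F τ.1 - (q τ.1).1))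
      (by rw [shiftExp_apply (τ := (τ.1, (q τ.1).1))]; exact hqpos)
    · exact hdead _ (by omega) hal
    · obtain ⟨τ', rfl⟩ := exists_of_shiftExp_ne_zero h.ne
      rw [shiftExp_apply] at h
      have := (hqF' τ' h.ne).2 h
      refine hβalive F _ ?_
      simp only
      omega
  let leads : Set (Fin n × ℕ) :=
    {τ | ∃ u ∈ adm, u τ ≠ 0 ∧ ∀ τ', u τ' ≠ 0 → slackKey 𝒰 β τ ≤ slackKey 𝒰 β τ'}
  have hleads : leads.Finite := hbox.subset fun τ ⟨u, hu, h, h'⟩ => hlead u hu τ h h'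
  have hwadm : w F ∈ adm := ⟨hwL F, hwQ, by rw [sub_self]; exact G.zero_mem⟩
  have hleads_ne : leads.Nonempty := by
    obtain ⟨τ, h⟩ := exists_lead (𝒰 := 𝒰) (β := β) (hne0 _ hwadm)
    exact ⟨τ, w F, hwadm, h⟩
  obtain ⟨τ, ⟨u, hu, huτ, humin⟩, hmax⟩ := Set.exists_max_image leads (slackKey 𝒰 β) hleads hleads_ne
  have hτbox := hlead u hu τ huτ humin
  have hulead : u ∈ leadingBelow 𝒰 β L τ := ⟨hu.1, fun τ' h => ⟨hu.2.1 τ' h, humin τ' h⟩⟩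
  obtain ⟨b, hb, s, c, rfl, hc⟩ := hBgen τ (hu.2.1 τ huτ) u hulead
  have hz := shiftExp_mem_leadingBelow (fun u hu h => hL u hu fun τ hτ => hQA (h τ hτ))
    (hB b hb) s (hu.2.1 _ huτ)
  have hzG : shiftExp s b.2 ∈ G := by
    refine ⟨(M F).shiftExp_mem' s (hBF b hb).1, fun τ' h => ?_⟩
    obtain ⟨τ', rfl⟩ := exists_of_shiftExp_ne_zero h
    rw [shiftExp_apply] at h
    have h1 := (hBF b hb).2 τ' h
    have h2 : b.1.2 + s < β F b.1.1 := hτbox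
    change τ'.2 + s < β F τ'.1
    omega
  have hu'lead := (leadingBelow 𝒰 β L _).sub_mem hulead ((leadingBelow 𝒰 β L _).zsmul_mem hz c)
  have hu'adm : u - c • shiftExp s b.2 ∈ adm := by
    refine ⟨hu'lead.1, fun τ' h => (hu'lead.2 τ' h).1, ?_⟩
    have := G.add_mem hu.2.2 (G.zsmul_mem hzG c)
    rwa [sub_add] at this
  obtain ⟨τ₁, hτ₁, hτ₁min⟩ := exists_lead (𝒰 := 𝒰) (β := β) (hne0 _ hu'adm)
  have heq := slackKey_injective
    (le_antisymm (hmax τ₁ ⟨_, hu'adm, hτ₁, hτ₁min⟩) (hu'lead.2 τ₁ hτ₁).2)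
  refine hτ₁ ?_
  rw [heq, Finsupp.sub_apply, Finsupp.smul_apply, shiftExp_apply, hc, smul_eq_mul, sub_self]

end FiniteDetermination

section PrimeSigmaIdeals

variable {R : Type*} [CommRing R] {σ : R →+* R}

/-- The colon ideal `(P : a)`. -/
def colonElem (P : Ideal R) (a : R) : Ideal R := Submodule.comap (LinearMap.mulLeft R a) P

theorem mem_colonElem {P : Ideal R} {a b : R} : b ∈ colonElem P a ↔ a * b ∈ P := Iff.rfl

theorem IsWellMixed.isSigmaIdeal_colonElem {P : Ideal R} (h : IsWellMixed σ P) (a : R) :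
    IsSigmaIdeal σ (colonElem P a) := fun b hb => h a b hb

theorem IsWellMixed.colonElem {P : Ideal R} (h : IsWellMixed σ P) (a : R) :
    IsWellMixed σ (colonElem P a) := by
  intro b c hbc
  rw [mem_colonElem, ← mul_assoc] at hbc ⊢
  exact h _ _ hbc

theorem isRadical_colonElem {P : Ideal R} (h : P.IsRadical) (a : R) :
    (colonElem P a).IsRadical := by
  rintro b ⟨k, hk⟩
  refine h ⟨k + 1, ?_⟩
  have : (a * b) ^ (k + 1) = a ^ k * b * (a * b ^ k) := by ring
  change (a * b) ^ (k + 1) ∈ P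
  rw [this]
  exact P.mul_mem_left _ hk

/-- A radical well-mixed σ-ideal is the intersection of the prime σ-ideals containing it. -/
theorem exists_prime_sigmaIdeal {I : Ideal R} (hσ : IsSigmaIdeal σ I) (hwm : IsWellMixed σ I)
    (hr : I.IsRadical) {s : R} (hs : s ∉ I) :
    ∃ P : Ideal R, P.IsPrime ∧ IsSigmaIdeal σ P ∧ I ≤ P ∧ s ∉ P := by
  obtain ⟨P, hIP, hP⟩ := zorn_le_nonempty₀
    {J : Ideal R | IsSigmaIdeal σ J ∧ IsWellMixed σ J ∧ J.IsRadical ∧ s ∉ J} (by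
      intro c hc hchain J hJ
      have hmem : ∀ {x}, x ∈ sSup c ↔ ∃ J ∈ c, x ∈ J :=
        Submodule.mem_sSup_of_directed ⟨J, hJ⟩ hchain.directedOn
      refine ⟨sSup c, ⟨fun x hx => ?_, fun x y hxy => ?_, ?_, fun hx => ?_⟩,
        fun J hJ => le_sSup hJ⟩
      · obtain ⟨J, hJ, hx⟩ := hmem.1 hx
        exact hmem.2 ⟨J, hJ, (hc hJ).1 x hx⟩
      · obtain ⟨J, hJ, hx⟩ := hmem.1 hxy
        exact hmem.2 ⟨J, hJ, (hc hJ).2.1 x y hx⟩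
      · rintro x ⟨k, hk⟩
        obtain ⟨J, hJ, hx⟩ := hmem.1 hk
        exact hmem.2 ⟨J, hJ, (hc hJ).2.2.1 ⟨k, hx⟩⟩
      · obtain ⟨J, hJ, hx⟩ := hmem.1 hx
        exact (hc hJ).2.2.2 hx)
    I ⟨hσ, hwm, hr, hs⟩
  obtain ⟨hPσ, hPwm, hPr, hsP⟩ := hP.prop
  have hcolon : ∀ a b, a * b ∈ P → b ∉ P → a * s ∈ P := by
    intro a b hab hb
    by_contra has
    have hle : P ≤ colonElem P a := fun x hx => P.mul_mem_left a hx
    exact hb (hP.le_of_ge ⟨hPwm.isSigmaIdeal_colonElem a, hPwm.colonElem a,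
      isRadical_colonElem hPr a, has⟩ hle hab)
  refine ⟨P, ⟨fun h => hsP (h ▸ Submodule.mem_top), fun {a b} hab => ?_⟩, hPσ, hIP, hsP⟩
  by_contra! hne
  have h1 := hcolon a b hab hne.2
  rw [mul_comm] at h1
  exact hsP (hPr ⟨2, by rw [pow_two]; exact hcolon s a h1 hne.1⟩)

variable (σ) (F : Set R)

theorem subset_rwmClosure : F ⊆ rwmClosure σ F := fun _ hx =>
  Submodule.mem_sInf.2 fun _ hI => hI.1 hx

theorem rwmClosure_isSigmaIdeal : IsSigmaIdeal σ (rwmClosure σ F) := fun x hx =>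
  Submodule.mem_sInf.2 fun I hI => hI.2.1 x (Submodule.mem_sInf.1 hx I hI)

theorem rwmClosure_isWellMixed : IsWellMixed σ (rwmClosure σ F) := fun x y hx =>
  Submodule.mem_sInf.2 fun I hI => hI.2.2.1 x y (Submodule.mem_sInf.1 hx I hI)

theorem rwmClosure_isRadical : (rwmClosure σ F).IsRadical := by
  rintro x ⟨k, hk⟩
  exact Submodule.mem_sInf.2 fun I hI => hI.2.2.2 ⟨k, Submodule.mem_sInf.1 hk I hI⟩

theorem subset_sigmaIdealGen : F ⊆ sigmaIdealGen σ F := fun _ hx =>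
  Submodule.mem_sInf.2 fun _ hI => hI.1 hx

theorem sigmaIdealGen_isSigmaIdeal : IsSigmaIdeal σ (sigmaIdealGen σ F) := fun x hx =>
  Submodule.mem_sInf.2 fun I hI => hI.2 x (Submodule.mem_sInf.1 hx I hI)

variable {σ F}

theorem rwmClosure_le {G : Set R} (h : F ⊆ rwmClosure σ G) :
    rwmClosure σ F ≤ rwmClosure σ G :=
  sInf_le ⟨h, rwmClosure_isSigmaIdeal σ G, rwmClosure_isWellMixed σ G, rwmClosure_isRadical σ G⟩

theorem sigmaIdealGen_le {I : Ideal R} (h : F ⊆ I) (hI : IsSigmaIdeal σ I) :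
    sigmaIdealGen σ F ≤ I :=
  sInf_le ⟨h, hI⟩

/-- Membership in a radical well-mixed closure can be tested on prime σ-ideals. -/
theorem mem_rwmClosure_of_forall_prime {s : R}
    (h : ∀ P : Ideal R, P.IsPrime → IsSigmaIdeal σ P → F ⊆ P → s ∈ P) : s ∈ rwmClosure σ F := by
  by_contra hs
  obtain ⟨P, hP, hPσ, hle, hsP⟩ := exists_prime_sigmaIdeal (rwmClosure_isSigmaIdeal σ F)
    (rwmClosure_isWellMixed σ F) (rwmClosure_isRadical σ F) hs
  exact hsP (h P hP hPσ ((subset_rwmClosure σ F).trans hle))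

end PrimeSigmaIdeals

section Binomials

variable {K : Type*} [Field K] {n : ℕ}

/-- The positive part of an exponent vector. -/
noncomputable def posExp (u : Fin n × ℕ →₀ ℤ) : Fin n × ℕ →₀ ℕ :=
  u.mapRange Int.toNat rfl

theorem posExp_apply (u : Fin n × ℕ →₀ ℤ) (τ : Fin n × ℕ) : posExp u τ = (u τ).toNat :=
  Finsupp.mapRange_apply ..

theorem posExp_shiftExp (s : ℕ) (u : Fin n × ℕ →₀ ℤ) :
    posExp (shiftExp s u) = shiftExp s (posExp u) := by
  ext τ
  by_cases hτ : ∃ τ' : Fin n × ℕ, τ = (τ'.1, τ'.2 + s)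
  · obtain ⟨τ', rfl⟩ := hτ
    rw [posExp_apply, shiftExp_apply, shiftExp_apply, posExp_apply]
  · have h1 : shiftExp s u τ = 0 := not_not.1 (mt exists_of_shiftExp_ne_zero hτ)
    have h2 : shiftExp s (posExp u) τ = 0 := not_not.1 (mt exists_of_shiftExp_ne_zero hτ)
    rw [posExp_apply, h1, h2]
    rfl

variable (K) in
/-- The pure binomial `Y^{u₊} - Y^{u₋}`. -/
noncomputable def pureBinomial (u : Fin n × ℕ →₀ ℤ) : DPoly K n :=
  MvPolynomial.monomial (posExp u) 1 - MvPolynomial.monomial (posExp (-u)) 1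

theorem pureBinomial_neg (u : Fin n × ℕ →₀ ℤ) : pureBinomial K (-u) = -pureBinomial K u := by
  simp [pureBinomial]

theorem pureBinomial_zero : pureBinomial K (0 : Fin n × ℕ →₀ ℤ) = 0 := by
  simp [pureBinomial]

/-- A difference of monomials is a monomial times the pure binomial of the exponent difference. -/
theorem exists_monomial_sub_eq (e e' : Fin n × ℕ →₀ ℕ) (u : Fin n × ℕ →₀ ℤ)
    (hu : ∀ τ, u τ = (e τ : ℤ) - e' τ) :
    ∃ d : Fin n × ℕ →₀ ℕ, (∀ τ, d τ ≠ 0 → e τ ≠ 0) ∧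
      (MvPolynomial.monomial e 1 - MvPolynomial.monomial e' 1 : DPoly K n) =
        MvPolynomial.monomial d 1 * pureBinomial K u := by
  refine ⟨e - posExp u, fun τ h => ?_, ?_⟩
  · rw [Finsupp.tsub_apply] at h
    omega
  have h1 : e = (e - posExp u) + posExp u := by
    ext τ
    have := hu τ
    simp only [Finsupp.add_apply, Finsupp.tsub_apply, posExp_apply]
    omega
  have h2 : e' = (e - posExp u) + posExp (-u) := by
    ext τ
    have := hu τ
    simp only [Finsupp.add_apply, Finsupp.tsub_apply, posExp_apply, Finsupp.neg_apply]
    omega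
  rw [pureBinomial, mul_sub, MvPolynomial.monomial_mul, MvPolynomial.monomial_mul, ← h1, ← h2,
    mul_one]

/-- Pure binomials in an ideal saturated with respect to the monomials in the variables of `A`
are closed under addition of exponents supported in `A`. -/
theorem pureBinomial_add_mem {J : Ideal (DPoly K n)} {A : Set (Fin n × ℕ)}
    (hsat : ∀ d : Fin n × ℕ →₀ ℕ, (∀ τ, d τ ≠ 0 → τ ∈ A) → ∀ g : DPoly K n,
      MvPolynomial.monomial d 1 * g ∈ J → g ∈ J)
    {u v : Fin n × ℕ →₀ ℤ} (hu : pureBinomial K u ∈ J) (hv : pureBinomial K v ∈ J)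
    (huA : ∀ τ, u τ ≠ 0 → τ ∈ A) (hvA : ∀ τ, v τ ≠ 0 → τ ∈ A) :
    pureBinomial K (u + v) ∈ J := by
  obtain ⟨d, hd, heq⟩ := exists_monomial_sub_eq (K := K) (posExp u + posExp v)
    (posExp (-u) + posExp (-v)) (u + v) (fun τ => by
      simp only [Finsupp.add_apply, posExp_apply, Finsupp.neg_apply]
      omega)
  refine hsat d (fun τ h => ?_) _ (heq ▸ ?_)
  · have := hd τ h
    by_cases h0 : u τ = 0
    · refine hvA τ fun h1 => this ?_
      simp [posExp_apply, h0, h1]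
    · exact huA τ h0
  · have : (MvPolynomial.monomial (posExp u + posExp v) 1 -
        MvPolynomial.monomial (posExp (-u) + posExp (-v)) 1 : DPoly K n) =
        MvPolynomial.monomial (posExp v) 1 * pureBinomial K u +
          MvPolynomial.monomial (posExp (-u)) 1 * pureBinomial K v := by
      simp only [pureBinomial, mul_sub, MvPolynomial.monomial_mul, mul_one]
      rw [add_comm (posExp v) (posExp u), add_comm (posExp v) (posExp (-u))]
      ring
    rw [this]
    exact J.add_mem (J.mul_mem_left _ hu) (J.mul_mem_left _ hv)

theorem monomial_mem_prime_iff {P : Ideal (DPoly K n)} (hP : P.IsPrime) (e : Fin n × ℕ →₀ ℕ) :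
    (MvPolynomial.monomial e 1 : DPoly K n) ∈ P ↔
      ∃ τ, e τ ≠ 0 ∧ (MvPolynomial.X τ : DPoly K n) ∈ P := by
  rw [MvPolynomial.monomial_eq, map_one, one_mul, Finsupp.prod, hP.prod_mem_iff]
  constructor
  · rintro ⟨τ, hτ, h⟩
    exact ⟨τ, by simpa using hτ, hP.mem_of_pow_mem _ h⟩
  · rintro ⟨τ, hτ, h⟩
    exact ⟨τ, by simpa using hτ, P.pow_mem_of_mem h _ (Nat.pos_of_ne_zero hτ)⟩

variable (σK : K →+* K)

theorem shift_X (τ : Fin n × ℕ) :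
    shift σK (MvPolynomial.X τ : DPoly K n) = MvPolynomial.X (τ.1, τ.2 + 1) := by
  simp [shift]

theorem shift_iterate_X (k : ℕ) (i : Fin n) (m : ℕ) :
    (shift σK)^[k] (MvPolynomial.X (i, m) : DPoly K n) = MvPolynomial.X (i, m + k) := by
  induction k with
  | zero => rfl
  | succ k ih => rw [Function.iterate_succ_apply', ih, shift_X, add_assoc]

theorem shift_monomial (e : Fin n × ℕ →₀ ℕ) :
    shift σK (MvPolynomial.monomial e 1 : DPoly K n) = MvPolynomial.monomial (shiftExp 1 e) 1 := by
  rw [MvPolynomial.monomial_eq, MvPolynomial.monomial_eq, map_one, one_mul, one_mul,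
    shiftExp, Finsupp.prod_mapDomain_index (fun _ => pow_zero _) (fun _ => pow_add _), Finsupp.prod,
    map_prod]
  exact Finset.prod_congr rfl fun τ _ => by rw [map_pow, shift_X]

theorem shift_pureBinomial (u : Fin n × ℕ →₀ ℤ) :
    shift σK (pureBinomial K u) = pureBinomial K (shiftExp 1 u) := by
  have h : -shiftExp 1 u = shiftExp 1 (-u) :=
    (map_neg (Finsupp.mapDomain.addMonoidHom (M := ℤ)
      fun τ : Fin n × ℕ => (τ.1, τ.2 + 1)) u).symm
  rw [pureBinomial, map_sub, shift_monomial, shift_monomial, pureBinomial, h, posExp_shiftExp,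
    posExp_shiftExp]

variable {σK}

/-- The model attached to a prime σ-ideal. -/
noncomputable def BinomialModel.ofPrime {P : Ideal (DPoly K n)} (hP : P.IsPrime)
    (hσ : IsSigmaIdeal (shift σK) P) : BinomialModel n where
  alive := {τ | (MvPolynomial.X τ : DPoly K n) ∉ P}
  good := {u | pureBinomial K u ∈ P}
  alive_of_succ i m h h' := h (by simpa only [shift_X] using hσ _ h')
  zero_mem := by simp [pureBinomial_zero]
  neg_mem u hu := by simpa [pureBinomial_neg] using hu
  add_mem u hu v hv hu' hv' := by
    refine pureBinomial_add_mem (fun d hd g hg => (hP.mem_or_mem hg).resolve_left ?_) hu hv hu' hv'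
    rw [monomial_mem_prime_iff hP]
    rintro ⟨τ, hτ, h⟩
    exact hd τ hτ h
  shiftExp_mem u hu := by
    have := hσ _ hu
    rwa [shift_pureBinomial] at this
  mem_of_dead := by
    rintro u ⟨τ, hτ, h⟩ ⟨τ', hτ', h'⟩
    simp only [Set.mem_ofPred_eq, not_not] at h h'
    refine P.sub_mem ((monomial_mem_prime_iff hP _).2 ⟨τ, ?_, h⟩)
      ((monomial_mem_prime_iff hP _).2 ⟨τ', ?_, h'⟩)
    all_goals
      simp only [posExp_apply, Finsupp.neg_apply]
      omega
  alive_pos := by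
    intro u hu hneg τ hτ h
    have h1 : (MvPolynomial.monomial (posExp u) 1 : DPoly K n) ∈ P :=
      (monomial_mem_prime_iff hP _).2 ⟨τ, by rw [posExp_apply]; omega, h⟩
    have h2 : (MvPolynomial.monomial (posExp (-u)) 1 : DPoly K n) ∈ P := by
      simpa [pureBinomial] using P.sub_mem h1 hu
    obtain ⟨τ', hτ', h'⟩ := (monomial_mem_prime_iff hP _).1 h2
    rw [posExp_apply, Finsupp.neg_apply] at hτ'
    exact absurd h' (hneg τ' (by omega))

/-- The exponent vectors supported in `A` of the pure binomials of an ideal which is saturated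
with respect to the monomials in the variables of `A`. -/
noncomputable def exponentLattice (J : Ideal (DPoly K n)) (A : Set (Fin n × ℕ))
    (hsat : ∀ d : Fin n × ℕ →₀ ℕ, (∀ τ, d τ ≠ 0 → τ ∈ A) → ∀ g : DPoly K n,
      MvPolynomial.monomial d 1 * g ∈ J → g ∈ J) : AddSubgroup (Fin n × ℕ →₀ ℤ) where
  carrier := {u | pureBinomial K u ∈ J ∧ ∀ τ, u τ ≠ 0 → τ ∈ A}
  zero_mem' := ⟨by rw [pureBinomial_zero]; exact J.zero_mem, by simp⟩
  add_mem' := by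
    rintro u v ⟨hu, hu'⟩ ⟨hv, hv'⟩
    refine ⟨pureBinomial_add_mem hsat hu hv hu' hv', fun τ h => ?_⟩
    by_cases h0 : u τ = 0
    · exact hv' τ (by simpa [h0] using h)
    · exact hu' τ h0
  neg_mem' := by
    rintro u ⟨hu, hu'⟩
    exact ⟨by rw [pureBinomial_neg]; exact J.neg_mem hu, fun τ h => hu' τ (by simpa using h)⟩

end Binomials

section Exponents

variable {K : Type*} [Field K] {n t : ℕ} (σK : K →+* K)

/-- The exponent vector of the monomial `Y^f`. -/
noncomputable def exponentOf (f : Fin n → Polynomial ℕ) : Fin n × ℕ →₀ ℕ :=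
  ∑ i, ∑ k ∈ Finset.range ((f i).natDegree + 1), Finsupp.single (i, k) ((f i).coeff k)

theorem exponentOf_apply (f : Fin n → Polynomial ℕ) (i : Fin n) (m : ℕ) :
    exponentOf f (i, m) = (f i).coeff m := by
  classical
  rw [exponentOf, Finsupp.finsetSum_apply, Finset.sum_eq_single i]
  · rw [Finsupp.finsetSum_apply, Finset.sum_eq_single m]
    · simp
    · intro k _ hk
      simp [hk]
    · intro hm
      rw [Finset.mem_range, not_lt] at hm
      simp [Polynomial.coeff_eq_zero_of_natDegree_lt hm]
  · intro i' _ hi'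
    rw [Finsupp.finsetSum_apply]
    exact Finset.sum_eq_zero fun k _ => by simp [hi']
  · simp

theorem exists_exponentOf_eq (e : Fin n × ℕ →₀ ℕ) : ∃ f, exponentOf f = e := by
  classical
  refine ⟨fun i => ∑ τ ∈ e.support, if τ.1 = i then Polynomial.monomial τ.2 (e τ) else 0, ?_⟩
  ext ⟨i, m⟩
  rw [exponentOf_apply, Polynomial.finsetSum_coeff, Finset.sum_eq_single (i, m)]
  · simp
  · rintro ⟨i', m'⟩ - h
    by_cases hi : i' = i
    · subst hi
      have : m' ≠ m := fun h' => h (by rw [h'])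
      simp [Polynomial.coeff_monomial, this]
    · simp [hi]
  · intro h
    simpa using h

theorem ypow_eq (i : Fin n) (p : Polynomial ℕ) : ypow σK i p =
    ∏ k ∈ Finset.range (p.natDegree + 1), (MvPolynomial.X (i, k) : DPoly K n) ^ p.coeff k := by
  rw [ypow, sexp]
  exact Finset.prod_congr rfl fun k _ => by rw [shift_iterate_X, zero_add]

theorem monom_eq_monomial (f : Fin n → Polynomial ℕ) :
    (monom σK f : DPoly K n) = MvPolynomial.monomial (exponentOf f) 1 := by
  rw [monom, exponentOf, MvPolynomial.monomial_sum_one]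
  refine Finset.prod_congr rfl fun i _ => ?_
  rw [ypow_eq, MvPolynomial.monomial_sum_one]
  exact Finset.prod_congr rfl fun k _ => MvPolynomial.X_pow_eq_monomial

theorem varPow_eq_X (i : Fin n) (a : ℕ) :
    (varPow σK i a : DPoly K n) = MvPolynomial.X (i, a) := by
  rw [varPow, ypow_eq, Polynomial.natDegree_X_pow, Finset.prod_eq_single a]
  · simp
  · intro k _ hk
    simp [Polynomial.coeff_X_pow, hk]
  · simp

/-- The variables outside the σ-ideal generated by `varSet σK j a`. -/
def freeRegion (j : Fin t → Fin n) (a : Fin t → ℕ) : Set (Fin n × ℕ) :=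
  {τ | ∀ i, j i = τ.1 → τ.2 < a i}

variable {σK} {j : Fin t → Fin n} {a : Fin t → ℕ}

theorem X_mem_of_varSet_subset {J : Ideal (DPoly K n)} (hJ : IsSigmaIdeal (shift σK) J)
    (h : varSet σK j a ⊆ J) {τ : Fin n × ℕ} (hτ : τ ∉ freeRegion j a) :
    (MvPolynomial.X τ : DPoly K n) ∈ J := by
  obtain ⟨i', m⟩ := τ
  simp only [freeRegion, Set.mem_ofPred_eq, not_forall, not_lt] at hτ
  obtain ⟨i, rfl, hm⟩ := hτ
  induction m, hm using Nat.le_induction with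
  | base => rw [← varPow_eq_X σK]; exact h ⟨i, rfl⟩
  | succ m _ ih => simpa only [shift_X] using hJ _ ih

theorem monomial_mem_sigmaIdealGen_varSet_iff (e : Fin n × ℕ →₀ ℕ) :
    (MvPolynomial.monomial e 1 : DPoly K n) ∈ sigmaIdealGen (shift σK) (varSet σK j a) ↔
      ∃ τ, e τ ≠ 0 ∧ τ ∉ freeRegion j a := by
  classical
  constructor
  · intro h
    have hle : sigmaIdealGen (shift σK) (varSet σK j a) ≤
        Ideal.span (MvPolynomial.X '' (freeRegion j a)ᶜ : Set (DPoly K n)) := by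
      refine sigmaIdealGen_le ?_ ?_
      · rintro _ ⟨i, rfl⟩
        refine Ideal.subset_span ⟨(j i, a i), fun h => lt_irrefl _ (h i rfl), ?_⟩
        exact (varPow_eq_X σK (j i) (a i)).symm
      · suffices hspan : Ideal.span (MvPolynomial.X '' (freeRegion j a)ᶜ : Set (DPoly K n)) ≤
            Ideal.comap (shift σK) (Ideal.span (MvPolynomial.X '' (freeRegion j a)ᶜ)) from
          fun x hx => hspan hx
        rw [Ideal.span_le]
        rintro _ ⟨τ, hτ, rfl⟩
        refine Ideal.subset_span ⟨(τ.1, τ.2 + 1), fun h => hτ fun i hi => ?_, (shift_X σK τ).symm⟩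
        exact (Nat.lt_succ_self _).trans (h i hi)
    obtain ⟨τ, hτ, h'⟩ := MvPolynomial.mem_ideal_span_X_image.1 (hle h) e (by simp)
    exact ⟨τ, h', hτ⟩
  · rintro ⟨τ, hτ, hfree⟩
    have hX := X_mem_of_varSet_subset (sigmaIdealGen_isSigmaIdeal (shift σK) (varSet σK j a))
      (subset_sigmaIdealGen _ _) hfree
    refine Ideal.mem_of_dvd _ ?_ hX
    rw [MvPolynomial.X_dvd_monomial]
    exact Or.inr hτ

theorem monomial_mem_Tset {e : Fin n × ℕ →₀ ℕ} (he : ∀ τ, e τ ≠ 0 → τ ∈ freeRegion j a) :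
    (MvPolynomial.monomial e 1 : DPoly K n) ∈ Tset σK j a := by
  obtain ⟨f, rfl⟩ := exists_exponentOf_eq e
  refine ⟨f, fun i => ?_, (monom_eq_monomial σK f).symm⟩
  rw [Polynomial.degree_lt_iff_coeff_zero]
  intro m hm
  by_contra h
  rw [← exponentOf_apply] at h
  exact absurd (he _ h i rfl) (not_lt.2 hm)

end Exponents

/-- If `I = ⟨I₀ ∪ {y_{j_1}^{x^{a_1}},…,y_{j_t}^{x^{a_t}}}⟩_r` is quasi-normal,
then `I` is finitely generated as a radical well-mixed σ-ideal. -/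
theorem stmt6 {K : Type*} [Field K] [CharZero K] {n t : ℕ} (σK : K →+* K)
    (j : Fin t → Fin n) (hj : Function.Injective j) (a : Fin t → ℕ)
    (I0 : Ideal (DPoly K n)) (hI0 : IsPureBinomialSigmaIdeal σK I0)
    (hqn : QuasiNormal σK j a I0) :
    FinGenAsRWM (shift σK)
      (rwmClosure (shift σK) ((I0 : Set (DPoly K n)) ∪ varSet σK j a)) := by
  obtain ⟨S, hS, rfl⟩ := hI0
  obtain ⟨hsat, hqn⟩ := hqn
  have hI0 := sigmaIdealGen_isSigmaIdeal (shift σK) S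
  set I0 := sigmaIdealGen (shift σK) S
  have hsat' : ∀ d : Fin n × ℕ →₀ ℕ, (∀ τ, d τ ≠ 0 → τ ∈ freeRegion j a) → ∀ g : DPoly K n,
      MvPolynomial.monomial d 1 * g ∈ I0 → g ∈ I0 :=
    fun d hd g hg => hsat g _ (monomial_mem_Tset hd) hg
  obtain ⟨F, hF⟩ := exists_finset_determining (freeRegion j a)
    (exponentLattice I0 (freeRegion j a) hsat')
    (fun u hu h => ⟨shift_pureBinomial σK u ▸ hI0 _ hu.1, h⟩)
  let G : Set (DPoly K n) :=
    (fun u : exponentLattice I0 (freeRegion j a) hsat' => pureBinomial K u.1) '' F ∪ varSet σK j a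
  have hG : G ⊆ (I0 : Set (DPoly K n)) ∪ varSet σK j a := by
    refine Set.union_subset_union_left _ ?_
    rintro _ ⟨u, -, rfl⟩
    exact u.2.1
  refine ⟨G, (F.finite_toSet.image _).union (Set.finite_range _),
    hG.trans (subset_rwmClosure _ _), le_antisymm (rwmClosure_le ?_)
      (rwmClosure_le (hG.trans (subset_rwmClosure _ _)))⟩
  refine Set.union_subset ?_ (Set.subset_union_right.trans (subset_rwmClosure _ _))
  refine sigmaIdealGen_le (fun p hp => ?_) (rwmClosure_isSigmaIdeal _ _)
  refine mem_rwmClosure_of_forall_prime fun P hP hPσ hGP => ?_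
  have hvar : varSet σK j a ⊆ P := Set.subset_union_right.trans hGP
  have hvarP : sigmaIdealGen (shift σK) (varSet σK j a) ≤ P := sigmaIdealGen_le hvar hPσ
  have hpI0 : p ∈ I0 := subset_sigmaIdealGen _ _ hp
  obtain ⟨f, g, rfl⟩ := hS p hp
  by_cases hf : monom σK f ∈ sigmaIdealGen (shift σK) (varSet σK j a)
  · exact P.sub_mem (hvarP hf) (hvarP (hqn f g hpI0 hf))
  by_cases hg : monom σK g ∈ sigmaIdealGen (shift σK) (varSet σK j a)
  · exact absurd (hqn g f (by simpa using I0.neg_mem hpI0) hg) hf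
  rw [monom_eq_monomial, monomial_mem_sigmaIdealGen_varSet_iff] at hf hg
  push Not at hf hg
  rw [monom_eq_monomial, monom_eq_monomial] at hpI0 ⊢
  let u : Fin n × ℕ →₀ ℤ := (exponentOf f).mapRange (fun k : ℕ => (k : ℤ)) rfl -
    (exponentOf g).mapRange (fun k : ℕ => (k : ℤ)) rfl
  obtain ⟨d, hd, heq⟩ := exists_monomial_sub_eq (K := K) (exponentOf f) (exponentOf g) u
    (fun τ => by simp [u])
  rw [heq] at hpI0 ⊢
  refine P.mul_mem_left _ (hF (BinomialModel.ofPrime hP hPσ) (fun τ hτ => ?_) (fun v hv => ?_) u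
    ⟨hsat' d (fun τ h => hf τ (hd τ h)) _ hpI0, fun τ h => ?_⟩)
  · by_contra hτ'
    exact hτ (X_mem_of_varSet_subset hPσ hvar hτ')
  · exact hGP (Or.inl ⟨v, hv, rfl⟩)
  · by_cases h0 : exponentOf f τ = 0
    · refine hg τ fun h1 => h ?_
      simp [u, h0, h1]
    · exact hf τ h0
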